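/- arXiv:1910.13189 — 6 statements merged into one kernel-verified Lean document; each statement's English description precedes it below -/
import Mathlib

section
/- The vanishing ideal I(Z_2^×) ⊆ F[z₁, z₂] of the finite set of points Z_2^× = {(c,d) : c, d ∈ R_n, c ≠ d} is generated by the two polynomials z₁^n − 1 and Σ_{i=0}^{n−1} z₁^i z₂^{n−1−i} (the latter being the polynomial quotient (z₂^n − z₁^n)/(z₂ − z₁)). -/
open MvPolynomial

/-- If an ideal contains a product of pairwise coprime elements `g c`, then it contains every
element lying in all the ideals `I ⊔ (g c)`. -/
theorem Ideal.mem_of_forall_mem_sup_span_singleton {ι R : Type*} [DecidableEq ι] [CommRing R]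
    (I : Ideal R) (s : Finset ι) (g : ι → R)
    (hg : Pairwise (Function.onFun IsCoprime fun i : s => g i)) (hprod : ∏ i ∈ s, g i ∈ I) {f : R}
    (hf : ∀ i ∈ s, f ∈ I ⊔ Ideal.span {g i}) : f ∈ I := by
  rcases s.eq_empty_or_nonempty with rfl | hs
  · have h1 : (1 : R) ∈ I := by simpa using hprod
    simpa using I.mul_mem_left f h1
  · obtain ⟨μ, hμ⟩ := (exists_sum_eq_one_iff_pairwise_coprime hs).mpr hg
    rw [← mul_one f, ← hμ, Finset.mul_sum]
    refine I.sum_mem fun i hi => ?_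
    obtain ⟨a, ha, b, hb, rfl⟩ := Submodule.mem_sup.mp (hf i hi)
    obtain ⟨r, rfl⟩ := Ideal.mem_span_singleton'.mp hb
    have key : (a + r * g i) * (μ i * ∏ j ∈ s \ {i}, g j) =
        (μ i * ∏ j ∈ s \ {i}, g j) * a + r * μ i * ∏ j ∈ s, g j := by
      rw [Finset.prod_eq_mul_prod_sdiff_singleton_of_mem hi]
      ring
    rw [key]
    exact I.add_mem (I.mul_mem_left _ ha) (I.mul_mem_left _ hprod)

theorem isCoprime_sub_algebraMap {F A : Type*} [Field F] [CommRing A] [Algebra F A] (x : A)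
    {c d : F} (h : c ≠ d) : IsCoprime (x - algebraMap F A c) (x - algebraMap F A d) := by
  simpa using (Polynomial.isCoprime_X_sub_C_of_isUnit_sub (sub_ne_zero.mpr h).isUnit).map
    (Polynomial.aeval x).toRingHom

theorem IsPrimitiveRoot.geom_sum₂_C_eq_prod {F : Type*} [Field F] [DecidableEq F] {ζ : F} {n : ℕ}
    (hn : 0 < n) (hζ : IsPrimitiveRoot ζ n) {c : F} (hc : c ^ n = 1) :
    ∑ i ∈ Finset.range n, (Polynomial.C c) ^ i * Polynomial.X ^ (n - 1 - i) =
      ∏ d ∈ (Polynomial.nthRootsFinset n (1 : F)).erase c,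
        (Polynomial.X - Polynomial.C d) := by
  have hmem : c ∈ Polynomial.nthRootsFinset n (1 : F) :=
    (Polynomial.mem_nthRootsFinset hn 1).mpr hc
  refine mul_right_cancel₀ (Polynomial.X_sub_C_ne_zero c) ?_
  rw [Finset.prod_erase_mul _ _ hmem, ← Polynomial.X_pow_sub_one_eq_prod hn hζ,
    ← neg_sub (Polynomial.C c), mul_neg, geom_sum₂_mul, ← Polynomial.C_pow, hc, neg_sub,
    Polynomial.C_1]

theorem MvPolynomial.sub_C_eval_mem {σ R : Type*} [CommRing R] (J : Ideal (MvPolynomial σ R))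
    (x : σ → R) (hx : ∀ i, X i - C (x i) ∈ J) (f : MvPolynomial σ R) :
    f - C (eval x f) ∈ J := by
  rw [← Ideal.Quotient.eq]
  have h : Ideal.Quotient.mk J = ((Ideal.Quotient.mk J).comp C).comp (eval x) := by
    ext i
    · simp
    · simpa using Ideal.Quotient.eq.mpr (hx i)
  exact congrArg (fun φ => φ f) h

theorem mem_span_pow_sub_one_geom_sum₂_iff {F : Type*} [Field F] {ζ : F} {n : ℕ}
    (hn : 0 < n) (hζ : IsPrimitiveRoot ζ n) (f : MvPolynomial (Fin 2) F) :
    f ∈ Ideal.span {(X 0 : MvPolynomial (Fin 2) F) ^ n - 1,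
        ∑ i ∈ Finset.range n, (X 0 : MvPolynomial (Fin 2) F) ^ i * X 1 ^ (n - 1 - i)} ↔
      ∀ p : F × F, p.1 ^ n = 1 → p.2 ^ n = 1 → p.1 ≠ p.2 → eval ![p.1, p.2] f = 0 := by
  classical
  set I := Ideal.span {(X 0 : MvPolynomial (Fin 2) F) ^ n - 1,
    ∑ i ∈ Finset.range n, (X 0 : MvPolynomial (Fin 2) F) ^ i * X 1 ^ (n - 1 - i)} with hI
  have hI₀ : (X 0 : MvPolynomial (Fin 2) F) ^ n - 1 ∈ I := Ideal.subset_span (by simp)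
  have hI₁ : ∑ i ∈ Finset.range n, (X 0 : MvPolynomial (Fin 2) F) ^ i * X 1 ^ (n - 1 - i) ∈ I :=
    Ideal.subset_span (by simp)
  constructor
  · rintro hf ⟨c, d⟩ hc hd hcd
    dsimp only at hc hd hcd ⊢
    suffices h : I ≤ RingHom.ker (eval ![c, d]) from h hf
    rw [hI, Ideal.span_le]
    rintro g (rfl | rfl)
    · simp [RingHom.mem_ker, hc]
    · have := geom_sum₂_mul c d n
      rw [hc, hd, sub_self, mul_eq_zero, or_iff_left (sub_ne_zero.mpr hcd)] at this
      simpa [RingHom.mem_ker] using this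
  · intro hf
    refine I.mem_of_forall_mem_sup_span_singleton (Polynomial.nthRootsFinset n (1 : F))
      (fun c => X 0 - C c) (fun c d hcd => isCoprime_sub_algebraMap _ (Subtype.coe_ne_coe.mpr hcd))
      ?_ fun c hc => ?_
    · have h := congrArg (Polynomial.aeval (X 0 : MvPolynomial (Fin 2) F))
        (Polynomial.X_pow_sub_one_eq_prod hn hζ)
      simp only [map_sub, map_pow, map_one, map_prod, Polynomial.aeval_X, Polynomial.aeval_C,
        algebraMap_eq] at h
      rwa [← h]
    rw [Polynomial.mem_nthRootsFinset hn] at hc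
    set J := I ⊔ Ideal.span {(X 0 : MvPolynomial (Fin 2) F) - C c}
    have hJ : (X 0 : MvPolynomial (Fin 2) F) - C c ∈ J :=
      Ideal.mem_sup_right (Ideal.mem_span_singleton_self _)
    refine J.mem_of_forall_mem_sup_span_singleton ((Polynomial.nthRootsFinset n (1 : F)).erase c)
      (fun d => X 1 - C d) (fun c d hcd => isCoprime_sub_algebraMap _ (Subtype.coe_ne_coe.mpr hcd))
      ?_ fun d hd => ?_
    · have h := congrArg (Polynomial.aeval (X 1 : MvPolynomial (Fin 2) F))
        (hζ.geom_sum₂_C_eq_prod hn hc)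
      simp only [map_sub, map_pow, map_mul, map_sum, map_prod, Polynomial.aeval_X,
        Polynomial.aeval_C, algebraMap_eq] at h
      have hJ₁ := (le_sup_left : I ≤ J) hI₁
      rw [← Ideal.Quotient.eq_zero_iff_mem] at hJ₁
      rw [← h, ← Ideal.Quotient.eq_zero_iff_mem, ← hJ₁]
      simp only [map_sum, map_mul, map_pow]
      rw [Ideal.Quotient.eq.mpr hJ]
    rw [Finset.mem_erase, Polynomial.mem_nthRootsFinset hn] at hd
    have h := sub_C_eval_mem (J ⊔ Ideal.span {(X 1 : MvPolynomial (Fin 2) F) - C d}) ![c, d]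
      (Fin.forall_fin_two.mpr ⟨Ideal.mem_sup_left hJ,
        Ideal.mem_sup_right (Ideal.mem_span_singleton_self _)⟩) f
    rwa [hf (c, d) hc hd.2 hd.1.symm, C_0, sub_zero] at h

theorem GaloisField.exists_isPrimitiveRoot {p m n : ℕ} [Fact p.Prime] (hm : m ≠ 0)
    (hdvd : n ∣ p ^ m - 1) : ∃ ζ : GaloisField p m, IsPrimitiveRoot ζ n := by
  obtain ⟨g, hg⟩ := IsCyclic.exists_ofOrder_eq_natCard (α := (GaloisField p m)ˣ)
  rw [Nat.card_units, GaloisField.card p m hm] at hg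
  have hpos : 0 < p ^ m - 1 :=
    Nat.sub_pos_of_lt (Nat.one_lt_pow hm (Fact.out : p.Prime).one_lt)
  obtain ⟨k, hk⟩ := hdvd
  have hg' : IsPrimitiveRoot (g : GaloisField p m) (p ^ m - 1) :=
    IsPrimitiveRoot.coe_units_iff.mpr (hg ▸ IsPrimitiveRoot.orderOf g)
  exact ⟨_, hg'.pow hpos (hk.trans (mul_comm n k))⟩

/-- the vanishing ideal of `Z_2^× = {(c,d) : c,d ∈ R_n, c ≠ d}` in `F[z₁,z₂]`
is generated by `z₁^n - 1` and `Σ_{i=0}^{n-1} z₁^i z₂^{n-1-i}`: a polynomial lies in the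
ideal generated by these two polynomials iff it vanishes at every point of `Z_2^×`. -/
theorem stmt_6 (m n : ℕ) (hm : 1 ≤ m) (hn : 0 < n) (hdvd : n ∣ 2 ^ m - 1) :
    ∀ f : MvPolynomial (Fin 2) (GaloisField 2 m),
      f ∈ Ideal.span {(X 0 : MvPolynomial (Fin 2) (GaloisField 2 m)) ^ n - 1,
          ∑ i ∈ Finset.range n,
            (X 0 : MvPolynomial (Fin 2) (GaloisField 2 m)) ^ i * X 1 ^ (n - 1 - i)} ↔
        ∀ p : GaloisField 2 m × GaloisField 2 m,
          p.1 ^ n = 1 → p.2 ^ n = 1 → p.1 ≠ p.2 → eval ![p.1, p.2] f = 0 := by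
  obtain ⟨_, hζ⟩ := GaloisField.exists_isPrimitiveRoot (Nat.one_le_iff_ne_zero.mp hm) hdvd
  exact mem_span_pow_sub_one_geom_sum₂_iff hn hζ
end

section
/- Suppose n = 2^m − 1, so that S_n = F. Then the common zero set in F² of the polynomials z₁^{n+1} − z₁ and (z₂ − z₁)^n − 1 is exactly Z_+^× = {(c,d) ∈ F² : c ≠ d}, and moreover the vanishing ideal I(Z_+^×) ⊆ F[z₁, z₂] of this set of points is generated by z₁^{n+1} − z₁ and (z₂ − z₁)^n − 1. -/
open MvPolynomial

theorem FiniteField.prod_X_sub_C_eq_X_pow_card_sub_X (K : Type*) [Field K] [Fintype K] :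
    ∏ a : K, (Polynomial.X - Polynomial.C a) = Polynomial.X ^ Fintype.card K - Polynomial.X := by
  have hdeg := FiniteField.X_pow_card_sub_X_natDegree_eq K (Fintype.one_lt_card (α := K))
  have hmonic : (Polynomial.X ^ Fintype.card K - Polynomial.X : Polynomial K).Monic :=
    Polynomial.monic_X_pow_sub (by
      rw [Polynomial.degree_X]
      exact_mod_cast Fintype.one_lt_card)
  have h := Polynomial.prod_multiset_X_sub_C_of_monic_of_roots_card_eq hmonic (by
    rw [FiniteField.roots_X_pow_card_sub_X, hdeg]
    rfl)
  rw [FiniteField.roots_X_pow_card_sub_X] at h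
  exact h

theorem MvPolynomial.prod_X_sub_C_eq_X_pow_card_sub_X {σ : Type*} (K : Type*) [Field K]
    [Fintype K] (i : σ) :
    ∏ a : K, (X i - C a : MvPolynomial σ K) = X i ^ Fintype.card K - X i := by
  simpa [map_prod, MvPolynomial.algebraMap_eq] using
    congrArg (Polynomial.aeval (X i : MvPolynomial σ K))
      (FiniteField.prod_X_sub_C_eq_X_pow_card_sub_X K)

/-- An ideal containing all the field equations contains every polynomial that vanishes at all
rational points. -/
theorem MvPolynomial.mem_of_forall_eval_eq_zero {σ K : Type*} [Finite σ] [Field K] [Fintype K]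
    {I : Ideal (MvPolynomial σ K)} (hI : ∀ i, X i ^ Fintype.card K - X i ∈ I)
    {f : MvPolynomial σ K} (hf : ∀ x, eval x f = 0) : f ∈ I := by
  obtain ⟨h, -, rfl⟩ := combinatorial_nullstellensatz_exists_linearCombination
    (fun _ : σ ↦ (Finset.univ : Finset K)) (fun _ ↦ Finset.univ_nonempty) f fun x _ ↦ hf x
  rw [Finsupp.linearCombination_apply]
  refine Ideal.sum_mem _ fun i _ ↦ ?_
  beta_reduce
  rw [MvPolynomial.prod_X_sub_C_eq_X_pow_card_sub_X]
  exact I.mul_mem_left _ (hI i)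

/-- for `n = 2^m - 1` (so `S_n = F`), the common zero set in `F²` of
`z₁^{n+1} - z₁` and `(z₂ - z₁)^n - 1` is exactly `Z_+^× = {(c,d) ∈ F² : c ≠ d}`, and the
vanishing ideal of `Z_+^×` is generated by these two polynomials. -/
theorem stmt_7 (m n : ℕ) (hm : 1 ≤ m) (hn : n = 2 ^ m - 1) :
    ({p : GaloisField 2 m × GaloisField 2 m |
        eval ![p.1, p.2] ((X 0 : MvPolynomial (Fin 2) (GaloisField 2 m)) ^ (n + 1) - X 0) = 0 ∧
        eval ![p.1, p.2] (((X 1 : MvPolynomial (Fin 2) (GaloisField 2 m)) - X 0) ^ n - 1) = 0}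
      = {p : GaloisField 2 m × GaloisField 2 m | p.1 ≠ p.2}) ∧
    (∀ f : MvPolynomial (Fin 2) (GaloisField 2 m),
      f ∈ Ideal.span {(X 0 : MvPolynomial (Fin 2) (GaloisField 2 m)) ^ (n + 1) - X 0,
          ((X 1 : MvPolynomial (Fin 2) (GaloisField 2 m)) - X 0) ^ n - 1} ↔
        ∀ p : GaloisField 2 m × GaloisField 2 m, p.1 ≠ p.2 → eval ![p.1, p.2] f = 0) := by
  have hn1 : n + 1 = 2 ^ m := by have := Nat.one_le_two_pow (n := m); omega
  have hn0 : n ≠ 0 := by have := Nat.one_lt_two_pow (n := m) (by omega); omega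
  have : Fintype (GaloisField 2 m) := Fintype.ofFinite _
  have hcard : Fintype.card (GaloisField 2 m) = n + 1 := by
    rw [← Nat.card_eq_fintype_card, GaloisField.card 2 m (by omega), hn1]
  have hpow (a : GaloisField 2 m) : a ^ (n + 1) = a := hcard ▸ FiniteField.pow_card a
  have hpow' {a : GaloisField 2 m} (ha : a ≠ 0) : a ^ n = 1 :=
    mul_right_cancel₀ ha (by rw [← pow_succ, hpow, one_mul])
  refine ⟨?_, fun f ↦ ⟨fun hf p hp ↦ ?_, fun hf ↦ ?_⟩⟩
  · ext ⟨c, d⟩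
    simp only [Set.mem_ofPred_eq, map_sub, map_pow, eval_X, map_one, Matrix.cons_val_zero,
      Matrix.cons_val_one, hpow, sub_self, true_and]
    constructor
    · rintro h rfl
      simp [hn0] at h
    · intro h
      rw [hpow' (sub_ne_zero.2 h.symm), sub_self]
  · refine (Ideal.span_le (I := RingHom.ker (eval ![p.1, p.2]))).2 ?_ hf
    rintro g (rfl | rfl)
    · simp [RingHom.mem_ker, hpow]
    · simp [RingHom.mem_ker, hpow' (sub_ne_zero.2 hp.symm)]
  · set I := Ideal.span {(X 0 : MvPolynomial (Fin 2) (GaloisField 2 m)) ^ (n + 1) - X 0,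
      ((X 1 : MvPolynomial (Fin 2) (GaloisField 2 m)) - X 0) ^ n - 1}
    have h0 : (X 0 : MvPolynomial (Fin 2) (GaloisField 2 m)) ^ (n + 1) - X 0 ∈ I :=
      Ideal.subset_span (by simp)
    have h1 : ((X 1 : MvPolynomial (Fin 2) (GaloisField 2 m)) - X 0) ^ n - 1 ∈ I :=
      Ideal.subset_span (by simp)
    have hfrob : ((X 1 : MvPolynomial (Fin 2) (GaloisField 2 m)) - X 0) ^ (n + 1) =
        X 1 ^ (n + 1) - X 0 ^ (n + 1) := by
      rw [hn1, sub_pow_char_pow]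
    have h2 : (X 1 : MvPolynomial (Fin 2) (GaloisField 2 m)) ^ (n + 1) - X 1 ∈ I := by
      convert I.add_mem (I.mul_mem_left (X 1 - X 0) h1) h0 using 1
      linear_combination -hfrob
    have hmem : f * (X 1 - X 0) ^ n ∈ I := by
      refine MvPolynomial.mem_of_forall_eval_eq_zero (fun i ↦ ?_) fun x ↦ ?_
      · rw [hcard]
        fin_cases i
        exacts [h0, h2]
      · by_cases hx : x 0 = x 1
        · simp [hx, hn0]
        · have hfx := hf (x 0, x 1) hx
          have hxe : ![x 0, x 1] = x := by ext i; fin_cases i <;> rfl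
          rw [hxe] at hfx
          rw [map_mul, hfx, zero_mul]
    convert I.sub_mem hmem (I.mul_mem_left f h1) using 1
    ring
end

section
/- (Macaulay's trick, part 1.) The ideal of P generated by {p_ι : 1 ≤ ι ≤ p} is equal to the vanishing ideal I({P_1, …, P_N}) of the finite set of points {P_1, …, P_N} ⊂ K^n, i.e. the ideal of all polynomials of P vanishing at every P_i. -/
open MvPolynomial

section FallingFactorial

variable {R : Type*} [CommRing R] {ι : Type*} [Fintype ι]

/-- The multivariate falling factorial `∏ l, x_l (x_l - 1) ⋯ (x_l - e_l + 1)`. -/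
noncomputable def mvFalling (R : Type*) [CommRing R] {ι : Type*} [Fintype ι] (e : ι → ℕ) :
    MvPolynomial ι R :=
  ∏ l, ∏ j ∈ Finset.range (e l), (X l - C (j : R))

theorem mvFalling_zero : mvFalling R (0 : ι → ℕ) = 1 := by
  simp [mvFalling]

theorem mvFalling_add_single [DecidableEq ι] (e : ι → ℕ) (l : ι) :
    mvFalling R (e + Pi.single l 1) = mvFalling R e * (X l - C (e l : R)) := by
  have key : ∀ i, ∏ j ∈ Finset.range ((e + Pi.single l 1 : ι → ℕ) i), (X i - C (j : R)) =
      (∏ j ∈ Finset.range (e i), (X i - C (j : R))) *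
        if i = l then X l - C (e l : R) else 1 := by
    intro i
    by_cases h : i = l
    · subst h
      simp [Finset.prod_range_succ]
    · simp [h]
  unfold mvFalling
  rw [Finset.prod_congr rfl fun i _ => key i, Finset.prod_mul_distrib]
  simp

theorem mvFalling_dvd {e e' : ι → ℕ} (h : e ≤ e') : mvFalling R e ∣ mvFalling R e' :=
  Finset.prod_dvd_prod_of_dvd _ _ fun l _ =>
    Finset.prod_dvd_prod_of_subset _ _ _ (Finset.range_subset_range.2 (h l))

theorem eval_mvFalling (e : ι → ℕ) (x : ι → R) :
    eval x (mvFalling R e) = ∏ l, ∏ j ∈ Finset.range (e l), (x l - (j : R)) := by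
  simp [mvFalling, map_prod]

theorem eval_mvFalling_of_not_le {e e' : ι → ℕ} (h : ¬ e ≤ e') :
    eval (fun l => (e' l : R)) (mvFalling R e) = 0 := by
  obtain ⟨l, hl⟩ := not_forall.1 h
  rw [eval_mvFalling]
  exact Finset.prod_eq_zero (Finset.mem_univ l)
    (Finset.prod_eq_zero (Finset.mem_range.2 (not_le.1 hl)) (sub_self _))

theorem span_range_mvFalling :
    Submodule.span R (Set.range (mvFalling R : (ι → ℕ) → MvPolynomial ι R)) = ⊤ := by
  classical
  refine eq_top_iff.2 fun f _ => ?_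
  induction f using MvPolynomial.induction_on with
  | C a =>
    have : (C a : MvPolynomial ι R) = a • mvFalling R 0 := by
      rw [mvFalling_zero, smul_eq_C_mul, mul_one]
    rw [this]
    exact Submodule.smul_mem _ _ (Submodule.subset_span ⟨0, rfl⟩)
  | add p q hp hq => exact Submodule.add_mem _ (hp trivial) (hq trivial)
  | mul_X p l hp =>
    refine Submodule.span_induction ?_ ?_ ?_ ?_ (hp trivial)
    · rintro _ ⟨e, rfl⟩
      have : mvFalling R e * X l =
          mvFalling R (e + Pi.single l 1) + (e l : R) • mvFalling R e := by
        rw [mvFalling_add_single, smul_eq_C_mul]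
        ring
      rw [this]
      exact Submodule.add_mem _ (Submodule.subset_span ⟨_, rfl⟩)
        (Submodule.smul_mem _ _ (Submodule.subset_span ⟨_, rfl⟩))
    · simp
    · intro x y _ _ hx hy
      rw [add_mul]
      exact Submodule.add_mem _ hx hy
    · intro a x _ hx
      rw [smul_mul_assoc]
      exact Submodule.smul_mem _ _ hx

/-- Evaluation at lattice points is triangular on falling factorials. -/
theorem eq_zero_of_eval_sum_mvFalling_eq_zero [IsDomain R] (S : Finset (ι → ℕ))
    (hS : ∀ e ∈ S, eval (fun l => (e l : R)) (mvFalling R e) ≠ 0) (c : (ι → ℕ) → R)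
    (h : ∀ e ∈ S, eval (fun l => (e l : R)) (∑ e' ∈ S, c e' • mvFalling R e') = 0) :
    ∀ e ∈ S, c e = 0 := by
  intro e
  induction e using WellFoundedLT.induction with
  | ind e ih =>
    intro he
    have h1 := h e he
    rw [map_sum, Finset.sum_eq_single_of_mem e he, smul_eval] at h1
    · exact (mul_eq_zero.1 h1).resolve_right (hS e he)
    · intro e' he' hne
      rw [smul_eval]
      by_cases hle : e' ≤ e
      · rw [ih e' (lt_of_le_of_ne hle hne) he', zero_mul]
      · rw [eval_mvFalling_of_not_le hle, mul_zero]

theorem eval_mvFalling_self_ne_zero [IsDomain R] (e : ι → ℕ)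
    (h : ringChar R = 0 ∨ ∀ l, e l < ringChar R) :
    eval (fun l => (e l : R)) (mvFalling R e) ≠ 0 := by
  rw [eval_mvFalling]
  refine Finset.prod_ne_zero_iff.2 fun l _ => Finset.prod_ne_zero_iff.2 fun j hj => ?_
  have hj' := Finset.mem_range.1 hj
  rw [← Nat.cast_sub hj'.le, Ne, ringChar.spec]
  intro hd
  rcases h with h | h
  · rw [h, zero_dvd_iff] at hd
    omega
  · have := Nat.le_of_dvd (by omega) hd
    have := h l
    omega

end FallingFactorial

/-- If the complement of `T` is finite, each coordinate of a vector outside the upper set `T`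
is smaller than any bound on the degrees of the minimal elements of `T`. -/
theorem lt_of_notMem_of_minimal_degree_le {ι : Type*} [Fintype ι] {T : Set (ι → ℕ)}
    (hup : IsUpperSet T) (hfin : Tᶜ.Finite) {δ : ℕ}
    (hδ : ∀ e, Minimal (· ∈ T) e → ∑ l, e l ≤ δ) {e : ι → ℕ} (he : e ∉ T) (l : ι) :
    e l < δ := by
  classical
  obtain ⟨a, ha⟩ : ∃ a : ℕ, (Pi.single l a : ι → ℕ) ∈ T := by
    by_contra! hcon
    exact Set.infinite_of_injective_forall_mem (s := Tᶜ)
      (Pi.single_injective (M := fun _ : ι => ℕ) l) hcon hfin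
  obtain ⟨g, hga, hg⟩ := exists_minimal_le_of_wellFoundedLT (· ∈ T) _ ha
  by_contra! hcon
  refine he (hup (fun i => ?_) hg.prop)
  by_cases hi : i = l
  · subst hi
    exact (Finset.single_le_sum (fun _ _ => Nat.zero_le _) (Finset.mem_univ i)).trans
      ((hδ g hg).trans hcon)
  · have := hga i
    rw [Pi.single_eq_of_ne hi] at this
    exact this.trans (Nat.zero_le _)

/-- Macaulay's trick, part 1. Identify monomials of `K[x_1,…,x_n]` with their
exponent vectors in `Fin nv → ℕ`. Let `T` be (the exponent set of) a zero-dimensional monomial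
ideal, i.e. an upward-closed set with finite complement, let `G` be its set of minimal
elements (the minimal monomial generating set), let `δ` bound the degrees of the members of
`G` and assume `char K = 0` or `char K > δ`. To each generator `t_ι` (exponent vector `e`)
associate `p_ι = ∏_l ∏_{j=0}^{e_l - 1} (x_l - j)`, and to each monomial `n_i ∉ T` (exponent
vector `e`) the point `P_i = (e_1, …, e_n) ∈ K^n`. Then the ideal generated by the `p_ι`
equals the vanishing ideal of the points `P_i`. -/
theorem stmt_9 (K : Type*) [Field K] (nv : ℕ)
    (T : Set (Fin nv → ℕ))
    (hup : ∀ e ∈ T, ∀ e' : Fin nv → ℕ, e ≤ e' → e' ∈ T)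
    (hfin : Tᶜ.Finite)
    (G : Set (Fin nv → ℕ))
    (hG : G = {e ∈ T | ∀ e' ∈ T, e' ≤ e → e' = e})
    (δ : ℕ) (hδ : ∀ e ∈ G, ∑ l, e l ≤ δ)
    (hchar : ringChar K = 0 ∨ δ < ringChar K) :
    ∀ f : MvPolynomial (Fin nv) K,
      f ∈ Ideal.span ((fun e : Fin nv → ℕ =>
            ∏ l, ∏ j ∈ Finset.range (e l), (X l - C (j : K))) '' G) ↔
        ∀ e ∉ T, eval (fun l => ((e l : ℕ) : K)) f = 0 := by
  have hup' : IsUpperSet T := fun a b hab ha => hup a ha b hab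
  have hGmin : ∀ e, e ∈ G ↔ Minimal (· ∈ T) e := by
    intro e
    rw [hG]
    exact ⟨fun h => ⟨h.1, fun y hy hle => (h.2 y hy hle).ge⟩,
      fun h => ⟨h.prop, fun y hy hle => le_antisymm hle (h.le_of_le hy hle)⟩⟩
  intro f
  change f ∈ Ideal.span (mvFalling K '' G) ↔ _
  set I := Ideal.span (mvFalling K '' G)
  have hvan : ∀ f ∈ I, ∀ e ∉ T, eval (fun l => (e l : K)) f = 0 := by
    intro f hf e he
    have hle : I ≤ RingHom.ker (eval fun l => (e l : K)) := by
      refine Ideal.span_le.2 ?_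
      rintro _ ⟨g, hg, rfl⟩
      exact eval_mvFalling_of_not_le fun hge => he (hup' hge ((hGmin g).1 hg).prop)
    exact hle hf
  refine ⟨hvan f, fun hf => ?_⟩
  have hmem : f ∈ I.restrictScalars K ⊔
      Submodule.span K (mvFalling K '' (hfin.toFinset : Set (Fin nv → ℕ))) := by
    have htop : Submodule.span K (Set.range (mvFalling K)) ≤ I.restrictScalars K ⊔
        Submodule.span K (mvFalling K '' (hfin.toFinset : Set (Fin nv → ℕ))) := by
      refine Submodule.span_le.2 ?_
      rintro _ ⟨e, rfl⟩
      by_cases he : e ∈ T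
      · obtain ⟨g, hge, hg⟩ := exists_minimal_le_of_wellFoundedLT (· ∈ T) e he
        exact Submodule.mem_sup_left (I.mem_of_dvd (mvFalling_dvd hge)
          (Ideal.subset_span ⟨g, (hGmin g).2 hg, rfl⟩))
      · exact Submodule.mem_sup_right (Submodule.subset_span ⟨e, by simpa using he, rfl⟩)
    rw [span_range_mvFalling] at htop
    exact htop trivial
  obtain ⟨r, hr, s, hs, rfl⟩ := Submodule.mem_sup.1 hmem
  obtain ⟨c, rfl⟩ := (Submodule.mem_span_image_finset_iff_exists_fun' K).1 hs
  have hr' : r ∈ I := hr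
  have hS : ∀ e ∈ hfin.toFinset, eval (fun l => (e l : K)) (mvFalling K e) ≠ 0 := by
    intro e he
    refine eval_mvFalling_self_ne_zero e (hchar.imp_right fun h l => ?_)
    exact (lt_of_notMem_of_minimal_degree_le hup' hfin
      (fun e he => hδ e ((hGmin e).2 he)) (by simpa using he) l).trans h
  have hc : ∀ e ∈ hfin.toFinset, c e = 0 := by
    refine eq_zero_of_eval_sum_mvFalling_eq_zero hfin.toFinset hS c fun e he => ?_
    have heT : e ∉ T := by simpa using he
    have := hf e heT
    rwa [map_add, hvan r hr' e heT, zero_add] at this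
  rw [Finset.sum_eq_zero fun e he => by rw [hc e he, zero_smul], add_zero]
  exact hr'
end

section
/- (Macaulay's trick, consequence for the quotient algebra.) The residue classes of the monomials n_1, …, n_N of N form a K-basis of the quotient algebra P / I({P_1, …, P_N}); equivalently, the evaluation map from the K-linear span of N to K^N sending f to (f(P_1), …, f(P_N)) is a K-linear isomorphism. -/
open MvPolynomial

/-- A factorial is nonzero in a field whose characteristic is zero or exceeds its argument. -/
theorem cast_factorial_ne_zero_of_lt_ringChar {K : Type*} [Field K] {m : ℕ}
    (h : ringChar K = 0 ∨ m < ringChar K) : ((m.factorial : ℕ) : K) ≠ 0 := by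
  rw [Ne, ringChar.spec]
  intro hdvd
  rcases h with h | h
  · rw [h, zero_dvd_iff] at hdvd
    exact m.factorial_ne_zero hdvd
  · rcases CharP.char_is_prime_or_zero K (ringChar K) with hp | hp
    · exact absurd (hp.dvd_factorial.1 hdvd) (not_le.2 h)
    · omega

/-- If the minimal elements of an upper set of exponents with finite complement have degree at
most `δ`, then every coordinate of an exponent outside the set is smaller than `δ`. -/
theorem coord_lt_of_notMem {ι : Type*} [Fintype ι] {T : Set (ι → ℕ)}
    (hup : ∀ e ∈ T, ∀ e' : ι → ℕ, e ≤ e' → e' ∈ T) (hfin : Tᶜ.Finite) {δ : ℕ}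
    (hδ : ∀ e ∈ T, (∀ e' ∈ T, e' ≤ e → e' = e) → ∑ l, e l ≤ δ)
    {e : ι → ℕ} (he : e ∉ T) (l : ι) : e l < δ := by
  classical
  have hex : ∃ d, Pi.single l d ∈ T := by
    by_contra! h
    exact Set.infinite_of_injective_forall_mem
      (Pi.single_injective (M := fun _ : ι => ℕ) l) h hfin
  have hmin : ∑ k, (Pi.single l (Nat.find hex) : ι → ℕ) k ≤ δ := by
    refine hδ _ (Nat.find_spec hex) fun e' he' hle => ?_
    have hsingle : e' = Pi.single l (e' l) := by
      funext k
      by_cases hk : k = l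
      · subst hk; simp
      · have := hle k
        simp_all
    have hl : e' l ≤ Nat.find hex := by simpa using hle l
    have hfind : Nat.find hex ≤ e' l := Nat.find_min' hex (hsingle ▸ he')
    rw [hsingle, le_antisymm hl hfind]
  rw [Finset.sum_pi_single'] at hmin
  simp only [Finset.mem_univ, if_true] at hmin
  refine lt_of_lt_of_le ?_ hmin
  by_contra! h
  exact he (hup _ (Nat.find_spec hex) e (by
    intro k
    by_cases hk : k = l
    · subst hk; simpa using h
    · simp [hk]))

/-- A product of univariate falling factorials, expanded in monomials. -/
theorem prod_cast_descFactorial_eq_sum {R ι : Type*} [CommRing R] [Nontrivial R]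
    [NoZeroDivisors R] [Fintype ι] [DecidableEq ι] (e i : ι → ℕ) :
    ∏ l, (((i l).descFactorial (e l) : ℕ) : R) =
      ∑ x ∈ Fintype.piFinset fun l => Finset.range (e l + 1),
        (∏ l, (descPochhammer R (e l)).coeff (x l)) * ∏ l, (i l : R) ^ x l := by
  simp_rw [← Finset.prod_mul_distrib]
  rw [← Finset.prod_univ_sum (fun l => Finset.range (e l + 1))
    fun l k => (descPochhammer R (e l)).coeff k * (i l : R) ^ k]
  refine Finset.prod_congr rfl fun l _ => ?_
  rw [← descPochhammer_eval_eq_descFactorial, Polynomial.eval_eq_sum_range,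
    descPochhammer_natDegree]

/-- If all moments of the weights `w` on a finite lower set of exponents, taken against the
monomials with exponent in that set, vanish, then so does `w`. -/
theorem eq_zero_of_forall_sum_mul_prod_pow_eq_zero {K ι : Type*} [Field K] [Fintype ι]
    {S : Finset (ι → ℕ)} (hS : IsLowerSet (S : Set (ι → ℕ)))
    (hchar : ∀ e ∈ S, ∀ l, (((e l).factorial : ℕ) : K) ≠ 0) (w : S → K)
    (hw : ∀ e ∈ S, ∑ i : S, w i * ∏ l, ((i : ι → ℕ) l : K) ^ e l = 0) : w = 0 := by
  classical
  have hdesc : ∀ e ∈ S,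
      ∑ i : S, w i * ∏ l, ((((i : ι → ℕ) l).descFactorial (e l) : ℕ) : K) = 0 := by
    intro e he
    simp_rw [prod_cast_descFactorial_eq_sum, Finset.mul_sum]
    rw [Finset.sum_comm]
    refine Finset.sum_eq_zero fun x hx => ?_
    have hxe : x ≤ e := fun l => by
      have := Fintype.mem_piFinset.1 hx l
      simpa [Nat.lt_succ_iff] using this
    simp_rw [mul_left_comm (w _)]
    rw [← Finset.mul_sum, hw x (hS hxe he), mul_zero]
  by_contra hne
  have hsupp : (Finset.univ.filter fun i => w i ≠ 0).Nonempty := by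
    obtain ⟨i, hi⟩ := Function.ne_iff.1 hne
    exact ⟨i, by simpa using hi⟩
  obtain ⟨m, hm⟩ := Finset.exists_maximal hsupp
  have hwm : w m ≠ 0 := (Finset.mem_filter.1 hm.prop).2
  have hsum := hdesc m m.2
  rw [Finset.sum_eq_single m] at hsum
  · refine mul_ne_zero hwm (Finset.prod_ne_zero_iff.2 fun l _ => ?_) hsum
    rw [Nat.descFactorial_self]
    exact hchar m m.2 l
  · intro i _ him
    by_cases hwi : w i = 0
    · rw [hwi, zero_mul]
    have hnle : ¬ m ≤ i := fun h => him (hm.eq_of_le (by simpa using hwi) h).symm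
    obtain ⟨l, hl⟩ : ∃ l, (i : ι → ℕ) l < (m : ι → ℕ) l := by
      by_contra! h
      exact hnle h
    rw [Finset.prod_eq_zero (Finset.mem_univ l), mul_zero]
    rw [Nat.descFactorial_eq_zero_iff_lt.2 hl, Nat.cast_zero]
  · simp

/-- Macaulay's trick, consequence for the quotient algebra. With the setup of
Macaulay's trick (`T` a zero-dimensional monomial ideal given by its exponent set, `G` its set
of minimal elements, `δ` a bound for the degrees of the members of `G`, `char K = 0` or
`char K > δ`, and to each monomial `n_i ∉ T` with exponent vector `e` the associated point
`P_i = (e_1, …, e_n) ∈ K^n`), the evaluation map sending a family of coefficients `c`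
(indexed by the monomials outside `T`) to the values at the points `P_i` of the polynomial
`Σ_j c_j n_j` in the span of those monomials is a `K`-linear bijection; equivalently, the
residue classes of the monomials outside `T` form a `K`-basis of `P / I({P_1,…,P_N})`. -/
theorem stmt_10 (K : Type*) [Field K] (nv : ℕ)
    (T : Set (Fin nv → ℕ))
    (hup : ∀ e ∈ T, ∀ e' : Fin nv → ℕ, e ≤ e' → e' ∈ T)
    (hfin : Tᶜ.Finite)
    (G : Set (Fin nv → ℕ))
    (hG : G = {e ∈ T | ∀ e' ∈ T, e' ≤ e → e' = e})
    (δ : ℕ) (hδ : ∀ e ∈ G, ∑ l, e l ≤ δ)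
    (hchar : ringChar K = 0 ∨ δ < ringChar K) :
    Function.Bijective (fun (c : hfin.toFinset → K) (i : hfin.toFinset) =>
      eval (fun l => (((i : Fin nv → ℕ) l : ℕ) : K))
        (∑ j : hfin.toFinset, monomial (Finsupp.equivFunOnFinite.symm (j : Fin nv → ℕ)) (c j))) := by
  have hlower : IsLowerSet (hfin.toFinset : Set (Fin nv → ℕ)) := by
    intro a b hba ha
    simp only [Set.Finite.coe_toFinset, Set.mem_compl_iff] at ha ⊢
    exact fun hb => ha (hup b hb a hba)
  have hfact : ∀ e ∈ hfin.toFinset, ∀ l, (((e l).factorial : ℕ) : K) ≠ 0 := by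
    intro e he l
    have hlt : e l < δ := coord_lt_of_notMem hup hfin
      (fun e he hmin => hδ e (hG ▸ ⟨he, hmin⟩)) (by simpa using he) l
    exact cast_factorial_ne_zero_of_lt_ringChar (hchar.imp_right hlt.trans)
  let V : Matrix hfin.toFinset hfin.toFinset K :=
    Matrix.of fun i j => ∏ l, ((i : Fin nv → ℕ) l : K) ^ (j : Fin nv → ℕ) l
  have hV : IsUnit V := by
    rw [← Matrix.vecMul_injective_iff_isUnit]
    refine (injective_iff_map_eq_zero V.vecMulLinear).2 fun w hw => ?_
    exact eq_zero_of_forall_sum_mul_prod_pow_eq_zero hlower hfact w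
      fun e he => congrFun hw ⟨e, he⟩
  have hbij : Function.Bijective V.mulVec :=
    ⟨Matrix.mulVec_injective_iff_isUnit.2 hV, Matrix.mulVec_surjective_iff_isUnit.2 hV⟩
  convert hbij using 1
  funext c i
  simp only [map_sum, eval_monomial, Matrix.mulVec, dotProduct, V, Matrix.of_apply]
  refine Finset.sum_congr rfl fun j _ => ?_
  rw [mul_comm, Finsupp.prod_fintype _ _ fun _ => pow_zero _]
  rfl
end

section
/- (Lazard's description in two variables.) Let X ⊂ K² be a finite set of distinct points, let π : K² → K be the projection π(a₁,a₂) = a₁, write π(X) = {a_0, …, a_{r−1}}, and set d(i) := #{P ∈ X : π(P) = a_i}; assume the a_i are numbered so that d(0) ≥ d(1) ≥ … ≥ d(r−1). Then the set of monomials N := {x₁^i x₂^j : 0 ≤ i < r, 0 ≤ j < d(i)} has cardinality #X, and the residue classes of the monomials of N form a K-basis of the quotient algebra K[x₁,x₂] / I(X), where I(X) is the vanishing ideal of X; equivalently, the evaluation map from the K-linear span of N to the space of K-valued functions on X is a K-linear isomorphism. -/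
open Polynomial in
/-- A family of coefficients `e i j`, `j < d i` with `d` antitone, is zero as soon as the
polynomial `∑ e i j x^i y^j` vanishes at `d k` points on each of the distinct lines `x = a k`. -/
theorem coeff_eq_zero_of_vanishing_on_columns {K : Type*} [Field K] {r D : ℕ} {a : Fin r → K}
    (ha : Function.Injective a) {d : Fin r → ℕ} (hd : Antitone d) (hD : ∀ i, d i ≤ D)
    {S : Fin r → Finset K} (hS : ∀ i, (S i).card = d i) {e : Fin r → ℕ → K}
    (he : ∀ i j, d i ≤ j → e i j = 0)
    (hv : ∀ k, ∀ y ∈ S k, ∑ j ∈ Finset.range D, (∑ i, e i j * a k ^ (i : ℕ)) * y ^ j = 0)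
    (i : Fin r) (j : ℕ) : e i j = 0 := by
  classical
  suffices h : ∀ m ≤ D, ∀ j, m ≤ j → ∀ i, e i j = 0 from h 0 (Nat.zero_le D) j (Nat.zero_le j) i
  intro m hm
  induction hm using Nat.decreasingInduction with
  | self => exact fun j hj i => he i j ((hD i).trans hj)
  | of_succ m hm ih =>
    have top_coeff (k : Fin r) (hk : m < d k) : ∑ i, e i m * a k ^ (i : ℕ) = 0 := by
      set q : K[X] := ∑ j ∈ Finset.range (m + 1), C (∑ i, e i j * a k ^ (i : ℕ)) * X ^ j with hq
      have hdeg : q.natDegree ≤ m := by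
        refine natDegree_sum_le_of_forall_le _ _ fun j hj => ?_
        exact (natDegree_C_mul_X_pow_le _ _).trans (Nat.lt_succ_iff.1 (Finset.mem_range.1 hj))
      have hzero : q = 0 := by
        refine eq_zero_of_natDegree_lt_card_of_eval_eq_zero' q (S k) (fun y hy => ?_) (by
          rw [hS]; exact hdeg.trans_lt hk)
        rw [← hv k y hy, hq, eval_finsetSum]
        simp only [eval_mul, eval_C, eval_pow, eval_X]
        refine Finset.sum_subset (Finset.range_subset_range.2 hm) fun j _ hj => ?_
        have hj' : m + 1 ≤ j := by simpa using hj
        simp [ih j hj']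
      have := congrArg (fun p => coeff p m) hzero
      simpa [hq, finsetSum_coeff, coeff_C_mul, coeff_X_pow, -map_sum, -map_mul] using this
    set T := Finset.univ.filter fun k : Fin r => m < d k with hT
    set p : K[X] := ∑ i, C (e i m) * X ^ (i : ℕ) with hp
    have hdeg : p.degree < (T.image a).card := by
      rw [Finset.card_image_of_injective _ ha]
      refine (degree_sum_le _ _).trans_lt ((Finset.sup_lt_iff (WithBot.bot_lt_coe _)).2 ?_)
      intro i _
      by_cases hi : m < d i
      · have hle : Finset.Iic i ⊆ T := fun k hk => by
          simpa [hT] using hi.trans_le (hd (Finset.mem_Iic.1 hk))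
        have hcard := Finset.card_le_card hle
        rw [Fin.card_Iic] at hcard
        exact (degree_C_mul_X_pow_le _ _).trans_lt (by exact_mod_cast hcard)
      · simp [he i m (not_lt.1 hi)]
    have hzero : p = 0 := by
      refine eq_zero_of_degree_lt_of_eval_finset_eq_zero (T.image a) hdeg fun x hx => ?_
      obtain ⟨k, hk, rfl⟩ := Finset.mem_image.1 hx
      simpa [hp, eval_finsetSum] using top_coeff k (by simpa [hT] using hk)
    intro j hj i
    obtain rfl | hj := hj.eq_or_lt
    · have := congrArg (fun p => coeff p (i : ℕ)) hzero
      simpa [hp, finsetSum_coeff, coeff_C_mul, coeff_X_pow, Fin.val_inj] using this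
    · exact ih j hj i


/-- Lazard's description in two variables. Let `X ⊂ K²` be a finite set of
distinct points, let `a_0, …, a_{r-1}` enumerate (without repetition) the first projection
`π(X)`, let `d(i)` be the number of points of `X` lying over `a_i`, and assume
`d(0) ≥ d(1) ≥ … ≥ d(r-1)`. Then the set of monomials
`N = {x₁^i x₂^j : 0 ≤ i < r, 0 ≤ j < d(i)}` has cardinality `#X`, and the evaluation map
from the `K`-linear span of `N` to the `K`-valued functions on `X` is a `K`-linear
isomorphism (equivalently, the residue classes of the monomials of `N` form a `K`-basis of
`K[x₁,x₂]/I(X)`). -/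
theorem stmt_12 (K : Type*) [Field K] [DecidableEq K] (X : Finset (K × K))
    (r : ℕ) (a : Fin r → K) (ha : Function.Injective a)
    (himg : ∀ x : K, (∃ P ∈ X, P.1 = x) ↔ ∃ i, a i = x)
    (d : Fin r → ℕ) (hd : ∀ i, d i = (X.filter fun P : K × K => P.1 = a i).card)
    (hmono : ∀ i j : Fin r, i ≤ j → d j ≤ d i) :
    Fintype.card ((i : Fin r) × Fin (d i)) = X.card ∧
    Function.Bijective (fun (c : ((i : Fin r) × Fin (d i)) → K) (P : X) =>
      ∑ p : (i : Fin r) × Fin (d i),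
        c p * (P : K × K).1 ^ (p.1 : ℕ) * (P : K × K).2 ^ (p.2 : ℕ)) := by
  have hcard : Fintype.card ((i : Fin r) × Fin (d i)) = X.card := by
    have hmaps : ∀ P ∈ X, P.1 ∈ Finset.univ.image a := fun P hP => by
      simpa using (himg P.1).1 ⟨P, hP, rfl⟩
    rw [Fintype.card_sigma, Finset.card_eq_sum_card_fiberwise hmaps,
      Finset.sum_image ha.injOn]
    simp [hd]
  refine ⟨hcard, ?_⟩
  let ev : (((i : Fin r) × Fin (d i)) → K) →ₗ[K] (X → K) :=
    { toFun := fun c P => ∑ p : (i : Fin r) × Fin (d i),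
        c p * (P : K × K).1 ^ (p.1 : ℕ) * (P : K × K).2 ^ (p.2 : ℕ)
      map_add' := fun c c' => by
        ext P
        simp [add_mul, Finset.sum_add_distrib]
      map_smul' := fun t c => by
        ext P
        simp [Finset.mul_sum, mul_assoc] }
  have hinj : Function.Injective ev := by
    rw [injective_iff_map_eq_zero]
    intro c hc
    let e : Fin r → ℕ → K := fun i j => if h : j < d i then c ⟨i, j, h⟩ else 0
    have hD (i : Fin r) : d i ≤ X.card := hd i ▸ Finset.card_filter_le _ _
    have hzero : ∀ i j, e i j = 0 := by
      refine coeff_eq_zero_of_vanishing_on_columns ha (fun i j h => hmono i j h) hD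
        (S := fun i => (X.filter fun P : K × K => P.1 = a i).image Prod.snd) (fun i => ?_)
        (fun i j h => dif_neg h.not_gt) fun k y hy => ?_
      · rw [hd, Finset.card_image_of_injOn]
        intro P hP Q hQ h
        simp only [Finset.coe_filter, Set.mem_ofPred_eq] at hP hQ
        exact Prod.ext (hP.2.trans hQ.2.symm) h
      · obtain ⟨⟨x, y⟩, hP, rfl⟩ := Finset.mem_image.1 hy
        obtain ⟨hP, rfl : x = a k⟩ := Finset.mem_filter.1 hP
        rw [show (0 : K) = ev c ⟨_, hP⟩ by rw [hc]; rfl]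
        simp only [ev, LinearMap.coe_mk, AddHom.coe_mk, Finset.sum_mul]
        rw [Finset.sum_comm, Fintype.sum_sigma]
        refine Finset.sum_congr rfl fun i _ => ?_
        rw [← Finset.sum_subset (Finset.range_subset_range.2 (hD i)), Finset.sum_range]
        · simp [e]
        · intro j _ hj
          simp_all [e]
    ext ⟨i, j⟩
    simpa [e] using hzero i j
  exact ⟨hinj, (LinearMap.injective_iff_surjective_of_finrank_eq_finrank
    (by simp [← hcard])).1 hinj⟩
end

section
/- (Odd-exponent parametrization of error-location pairs.) Suppose n is odd and b ∈ F is an element of multiplicative order exactly n (a primitive n-th root of unity). Then the map sending a pair (c, j), with c ∈ R_n and 0 ≤ j < (n−1)/2, to the two-element set {c, c·b^{2j+1}} is a bijection from R_n × {0, 1, …, (n−3)/2} onto the set of all two-element subsets of R_n. In particular every ordered pair (c,d) with c, d ∈ R_n and c ≠ d can be written in exactly one way as either (e, e·b^k) or (e·b^k, e) with e ∈ R_n and k odd, 1 ≤ k ≤ n−2. -/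
/-- For a primitive `n`-th root of unity `b` with `n` odd, every ordered pair of distinct `n`-th
roots of unity is, in exactly one way, `(e, e * b ^ k)` or `(e * b ^ k, e)` with `k` odd. -/
theorem IsPrimitiveRoot.existsUnique_odd_pow_pair {F : Type*} [Field F] {n : ℕ} {b : F}
    (hb : IsPrimitiveRoot b n) (hodd : Odd n) {c d : F} (hc : c ^ n = 1) (hd : d ^ n = 1)
    (hcd : c ≠ d) :
    ∃! q : F × ℕ, q.1 ^ n = 1 ∧ Odd q.2 ∧ 1 ≤ q.2 ∧ q.2 ≤ n - 2 ∧
      ((c, d) = (q.1, q.1 * b ^ q.2) ∨ (c, d) = (q.1 * b ^ q.2, q.1)) := by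
  have hn : n ≠ 0 := hodd.pos.ne'
  have : NeZero n := ⟨hn⟩
  have hc0 : c ≠ 0 := by rintro rfl; simp [hn] at hc
  obtain ⟨i, hin, hi⟩ := hb.eq_pow_of_pow_eq_one (ξ := d / c) (by rw [div_pow, hc, hd, div_one])
  obtain rfl : d = c * b ^ i := by rw [hi]; field_simp
  have hi0 : i ≠ 0 := by rintro rfl; simp at hcd
  have forward : ∀ k < n, c * b ^ i = c * b ^ k → k = i := fun k hk h =>
    hb.pow_inj hk hin (mul_left_cancel₀ hc0 h).symm
  have backward : ∀ k < n, c = c * b ^ i * b ^ k → k + i = n := by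
    intro k hk h
    have hone : b ^ (i + k) = 1 := by
      apply mul_left_cancel₀ hc0
      rw [pow_add, ← mul_assoc, ← h, mul_one]
    obtain ⟨t, ht⟩ := hb.dvd_of_pow_eq_one _ hone
    have ht1 : t = 1 := by
      have : t < 2 := by by_contra! h2; nlinarith
      have : t ≠ 0 := by rintro rfl; omega
      omega
    subst ht1
    omega
  obtain ⟨r, hr⟩ := hodd
  rcases Nat.even_or_odd' i with ⟨j, hj | hj⟩
  · refine ⟨(c * b ^ i, n - i), ⟨hd, ⟨r - j, by grind⟩, by grind, by grind, Or.inr ?_⟩, ?_⟩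
    · rw [Prod.mk.injEq]
      exact ⟨by rw [mul_assoc, ← pow_add, Nat.add_sub_cancel' hin.le, hb.pow_eq_one, mul_one], rfl⟩
    · rintro ⟨e, k⟩ ⟨-, ⟨l, hl⟩, -, hk, h | h⟩ <;> dsimp only at hl hk h <;>
        obtain ⟨h₁, h₂⟩ := Prod.mk.inj h
      · subst h₁
        have := forward k (by omega) h₂
        omega
      · subst h₂
        have := backward k (by omega) h₁
        rw [Prod.mk.injEq]
        exact ⟨rfl, by omega⟩
  · refine ⟨(c, i), ⟨hc, ⟨j, hj⟩, by grind, by grind, Or.inl rfl⟩, ?_⟩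
    rintro ⟨e, k⟩ ⟨-, ⟨l, hl⟩, -, hk, h | h⟩ <;> dsimp only at hl hk h <;>
      obtain ⟨h₁, h₂⟩ := Prod.mk.inj h
    · subst h₁
      rw [forward k (by omega) h₂]
    · subst h₂
      have := backward k (by omega) h₁
      omega

/-- odd-exponent parametrization of error-location pairs. Let
`F = GF(2^m)`, `n ∣ 2^m - 1` (`n` odd) and let `b ∈ F` have multiplicative order exactly
`n`. The map `(c, j) ↦ {c, c·b^{2j+1}}`, for `c ∈ R_n` and `0 ≤ j < (n-1)/2`, is a
bijection from `R_n × {0,…,(n-3)/2}` onto the two-element subsets of `R_n`: it lands in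
that codomain, and every two-element subset of `R_n` has exactly one preimage. In
particular every ordered pair `(c,d)` of distinct elements of `R_n` can be written in
exactly one way as `(e, e·b^k)` or `(e·b^k, e)` with `e ∈ R_n` and `k` odd,
`1 ≤ k ≤ n - 2`. -/
theorem stmt_15 (m n : ℕ) (hm : 1 ≤ m) (hn : 0 < n) (hdvd : n ∣ 2 ^ m - 1)
    (b : GaloisField 2 m) (hb : orderOf b = n) :
    (∀ c : GaloisField 2 m, c ^ n = 1 → ∀ j : ℕ, j < (n - 1) / 2 →
      ({c, c * b ^ (2 * j + 1)} : Set (GaloisField 2 m)) ⊆ {e | e ^ n = 1} ∧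
      ({c, c * b ^ (2 * j + 1)} : Set (GaloisField 2 m)).ncard = 2) ∧
    (∀ s : Set (GaloisField 2 m), s ⊆ {e | e ^ n = 1} → s.ncard = 2 →
      ∃! p : GaloisField 2 m × ℕ, p.1 ^ n = 1 ∧ p.2 < (n - 1) / 2 ∧
        s = {p.1, p.1 * b ^ (2 * p.2 + 1)}) ∧
    (∀ c d : GaloisField 2 m, c ^ n = 1 → d ^ n = 1 → c ≠ d →
      ∃! q : GaloisField 2 m × ℕ, q.1 ^ n = 1 ∧ Odd q.2 ∧ 1 ≤ q.2 ∧ q.2 ≤ n - 2 ∧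
        ((c, d) = (q.1, q.1 * b ^ q.2) ∨ (c, d) = (q.1 * b ^ q.2, q.1))) := by
  have hodd : Odd n := by
    refine Odd.of_dvd_nat ?_ hdvd
    exact Nat.Even.sub_odd Nat.one_le_two_pow (Nat.even_pow.2 ⟨even_two, by omega⟩) odd_one
  have hprim : IsPrimitiveRoot b n := hb ▸ IsPrimitiveRoot.orderOf b
  obtain ⟨r, hr⟩ := id hodd
  refine ⟨fun c hc j hj => ⟨?_, ?_⟩, fun s hs hcard => ?_,
    fun c d hc hd hcd => hprim.existsUnique_odd_pow_pair hodd hc hd hcd⟩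
  · rintro x (rfl | rfl)
    · exact hc
    · change (c * b ^ (2 * j + 1)) ^ n = 1
      rw [mul_pow, hc, one_mul, pow_right_comm, hprim.pow_eq_one, one_pow]
  · have hc0 : c ≠ 0 := by rintro rfl; simp [hn.ne'] at hc
    refine Set.ncard_pair fun h => ?_
    exact hprim.pow_ne_one_of_pos_of_lt (l := 2 * j + 1) (by omega) (by omega)
      (mul_left_cancel₀ hc0 (by rw [← h, mul_one]))
  · obtain ⟨c, d, hcd, rfl⟩ := Set.ncard_eq_two.1 hcard
    obtain ⟨⟨e, k⟩, ⟨he, ⟨j, hj⟩, -, hk, hpair⟩, huniq⟩ :=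
      hprim.existsUnique_odd_pow_pair hodd (hs (by simp)) (hs (by simp)) hcd
    dsimp only at he hj hk hpair
    subst hj
    refine ⟨(e, j), ⟨he, by dsimp only; omega, ?_⟩, ?_⟩
    · rw [Set.pair_eq_pair_iff]
      simpa only [Prod.mk.injEq] using hpair
    · rintro ⟨e', j'⟩ ⟨he', hj', hset⟩
      dsimp only at he' hj' hset
      rw [Set.pair_eq_pair_iff] at hset
      have h := huniq (e', 2 * j' + 1) ⟨he', ⟨j', rfl⟩, by dsimp only; omega, by dsimp only; omega,
        by simpa only [Prod.mk.injEq] using hset⟩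
      obtain ⟨h₁, h₂⟩ := Prod.mk.inj h
      rw [Prod.mk.injEq]
      exact ⟨h₁, by omega⟩
end
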